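/- arXiv:2411.07679 — 9 statements merged into one kernel-verified Lean document; each statement's English description precedes it below -/
import Mathlib

section
/- Let a ≥ 2, b ≥ 1, and let Θ ⊆ P_b be a nonempty compact set whose type intensity κ(Θ) is well defined (the feasibility constraint in its definition is satisfied by some pair) and satisfies κ(Θ) ≥ 0. Then for any reals μ, ν with 0 ≤ ν ≤ μ there exists a payoff matrix A ∈ ℝ^{a×b} with μ_Θ(A) ≤ μ and ν_Θ(A) ≥ ν such that for every λ ∈ [0,1] and every strategy π : conv(Θ) → P_a, if Δ(0;π) ≤ (1−λ)(μ−ν) then the risk of π is at least (κ(Θ)μ − ν)(1+λ). -/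
open Finset

noncomputable section

/-- The standard probability simplex in `ℝⁿ`. -/
def simplex (n : ℕ) : Set (Fin n → ℝ) :=
  {x | (∀ i, 0 ≤ x i) ∧ ∑ i, x i = 1}

/-- Bilinear payoff `xᵀ A y`. -/
def pay {a b : ℕ} (A : Matrix (Fin a) (Fin b) ℝ) (x : Fin a → ℝ) (y : Fin b → ℝ) : ℝ :=
  ∑ i, ∑ j, x i * A i j * y j

/-- Best-response payoff of Player 1 against `y`. -/
def br {a b : ℕ} (A : Matrix (Fin a) (Fin b) ℝ) (y : Fin b → ℝ) : ℝ :=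
  sSup {v | ∃ x ∈ simplex a, v = pay A x y}

/-- `μ_Θ(A) = max_{y∈Θ} max_{x∈P_a} |xᵀAy|`. -/
def muTheta {a b : ℕ} (Θ : Set (Fin b → ℝ)) (A : Matrix (Fin a) (Fin b) ℝ) : ℝ :=
  sSup {v | ∃ y ∈ Θ, ∃ x ∈ simplex a, v = |pay A x y|}

/-- `ν_Θ(A) = min_{y∈Θ} max_{x∈P_a} xᵀAy`. -/
def nuTheta {a b : ℕ} (Θ : Set (Fin b → ℝ)) (A : Matrix (Fin a) (Fin b) ℝ) : ℝ :=
  sInf {v | ∃ y ∈ Θ, v = br A y}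

/-- ℓ¹ distance on `ℝⁿ`. -/
def l1 {n : ℕ} (y z : Fin n → ℝ) : ℝ := ∑ j, |y j - z j|

/-- ℓ¹ diameter `η(Θ)`. -/
def diam {b : ℕ} (Θ : Set (Fin b → ℝ)) : ℝ :=
  sSup {v | ∃ y ∈ Θ, ∃ z ∈ Θ, v = l1 y z}

/-- Payoff gap `Δ(ε;π)`. -/
def gap {a b : ℕ} (Θ : Set (Fin b → ℝ)) (A : Matrix (Fin a) (Fin b) ℝ)
    (π : (Fin b → ℝ) → (Fin a → ℝ)) (ε : ℝ) : ℝ :=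
  sSup {v | ∃ ystar ∈ Θ, ∃ yhat ∈ convexHull ℝ Θ, l1 yhat ystar ≤ ε ∧
    v = br A ystar - pay A (π yhat) ystar}

/-- Risk `sup_{ε>0} Δ(ε;π)`. -/
def risk {a b : ℕ} (Θ : Set (Fin b → ℝ)) (A : Matrix (Fin a) (Fin b) ℝ)
    (π : (Fin b → ℝ) → (Fin a → ℝ)) : ℝ :=
  sSup {v | ∃ ε : ℝ, 0 < ε ∧ v = gap Θ A π ε}

/-- The set of values over which the type intensity `κ(Θ)` is a supremum: pairs `y, z ∈ Θ`
satisfying `Σ_{i : y_i ≤ z_i} y_i < Σ_{i : y_i > z_i} y_i`, contributing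
`Σ_{i : y_i ≤ z_i} z_i − Σ_{i : y_i > z_i} z_i`. -/
def kappaSet {b : ℕ} (Θ : Set (Fin b → ℝ)) : Set ℝ :=
  {v | ∃ y ∈ Θ, ∃ z ∈ Θ,
    (∑ i ∈ Finset.univ.filter (fun i => y i ≤ z i), y i) <
      (∑ i ∈ Finset.univ.filter (fun i => ¬ y i ≤ z i), y i) ∧
    v = (∑ i ∈ Finset.univ.filter (fun i => y i ≤ z i), z i) -
      (∑ i ∈ Finset.univ.filter (fun i => ¬ y i ≤ z i), z i)}

/-- Type intensity `κ(Θ)`. -/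
def kappa {b : ℕ} (Θ : Set (Fin b → ℝ)) : ℝ := sSup (kappaSet Θ)

lemma kappa_le_one_aux {b : ℕ} (Θ : Set (Fin b → ℝ)) (hsub : Θ ⊆ simplex b) :
    kappa Θ ≤ 1 := by
  apply Real.sSup_le _ zero_le_one
  rintro v ⟨y, hy, z, hz, -, rfl⟩
  obtain ⟨h0, h1⟩ := hsub hz
  have e := Finset.sum_filter_add_sum_filter_not Finset.univ (fun i => y i ≤ z i) z
  have n : 0 ≤ ∑ i ∈ Finset.univ.filter (fun i => ¬ y i ≤ z i), z i :=
    Finset.sum_nonneg fun i _ => h0 i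
  linarith

lemma exists_coord_aux {b : ℕ} (Θ : Set (Fin b → ℝ)) (hsub : Θ ⊆ simplex b)
    (hwd : (kappaSet Θ).Nonempty) : ∃ y ∈ Θ, ∃ z ∈ Θ, ∃ j, y j < z j := by
  obtain ⟨v, y, hy, z, hz, hlt, -⟩ := hwd
  by_contra! hcon
  have hyz : ∀ j, y j ≤ z j := fun j => hcon z hz y hy j
  have h1 : Finset.univ.filter (fun i => y i ≤ z i) = Finset.univ := by simp [hyz]
  have h2 : Finset.univ.filter (fun i => ¬ y i ≤ z i) = ∅ := by
    ext i; simpa using hyz i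
  rw [h1, h2, (hsub hy).2] at hlt
  simp at hlt
  linarith

lemma pay_aux {a b : ℕ} (i0 : Fin a) (f : Fin b → ℝ) (μ ν : ℝ) (x : Fin a → ℝ)
    (hx : x ∈ simplex a) (y : Fin b → ℝ) (hy : y ∈ simplex b) :
    pay (fun i j => ν + (μ - ν) * ((if i = i0 then 2 else 0) - 1) * f j) x y
      = ν + (μ - ν) * (2 * x i0 - 1) * ∑ j, f j * y j := by
  unfold pay
  have h1 : ∀ i, ∑ j, x i * (ν + (μ - ν) * ((if i = i0 then 2 else 0) - 1) * f j) * y j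
      = ν * x i + (μ - ν) * (∑ j, f j * y j) * (2 * (if i = i0 then x i else 0) - x i) := by
    intro i
    have : ∀ j, x i * (ν + (μ - ν) * ((if i = i0 then 2 else 0) - 1) * f j) * y j
        = (x i * ν) * y j + x i * ((μ - ν) * ((if i = i0 then 2 else 0) - 1)) * (f j * y j) := by
      intro j; ring
    simp_rw [this]
    rw [Finset.sum_add_distrib, ← Finset.mul_sum, ← Finset.mul_sum, hy.2]
    split_ifs <;> ring
  simp_rw [h1]
  rw [Finset.sum_add_distrib, ← Finset.mul_sum, ← Finset.mul_sum, Finset.sum_sub_distrib,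
    ← Finset.mul_sum, hx.2]
  simp
  ring

/-- **Theorem 2 (NFG Impossibility).** If `a ≥ 2`, `Θ ⊆ P_b` is nonempty and compact with
well-defined type intensity `κ(Θ) ≥ 0`, then for all `0 ≤ ν ≤ μ` there is a payoff matrix `A`
with `μ_Θ(A) ≤ μ` and `ν_Θ(A) ≥ ν` such that for every `λ ∈ [0,1]`, any strategy missing at most
`(1−λ)(μ−ν)` opportunity incurs at least `(κ(Θ)μ−ν)(1+λ)` risk. -/
theorem nfg_impossibility {a b : ℕ} (ha : 2 ≤ a) (hb : 1 ≤ b)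
    (Θ : Set (Fin b → ℝ)) (hne : Θ.Nonempty) (hcomp : IsCompact Θ) (hsub : Θ ⊆ simplex b)
    (hwd : (kappaSet Θ).Nonempty) (hκ : 0 ≤ kappa Θ)
    (μ ν : ℝ) (hν0 : 0 ≤ ν) (hνμ : ν ≤ μ) :
    ∃ A : Matrix (Fin a) (Fin b) ℝ, muTheta Θ A ≤ μ ∧ ν ≤ nuTheta Θ A ∧
      ∀ lam : ℝ, 0 ≤ lam → lam ≤ 1 →
        ∀ π : (Fin b → ℝ) → (Fin a → ℝ),
          (∀ yhat ∈ convexHull ℝ Θ, π yhat ∈ simplex a) →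
          gap Θ A π 0 ≤ (1 - lam) * (μ - ν) →
          (kappa Θ * μ - ν) * (1 + lam) ≤ risk Θ A π := by
  obtain ⟨y, hy, z, hz, j, hyz⟩ := exists_coord_aux Θ hsub hwd
  have hκ1 := kappa_le_one_aux Θ hsub
  have hcont : ContinuousOn (fun w : Fin b → ℝ => w j) Θ := (continuous_apply j).continuousOn
  obtain ⟨p, hp, hpmin⟩ := hcomp.exists_isMinOn hne hcont
  obtain ⟨q, hq, hqmax⟩ := hcomp.exists_isMaxOn hne hcont
  have hmin : ∀ w ∈ Θ, p j ≤ w j := fun w hw => hpmin hw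
  have hmax : ∀ w ∈ Θ, w j ≤ q j := fun w hw => hqmax hw
  have hpq : 0 < q j - p j := by linarith [hmin y hy, hmax z hz]
  let f : Fin b → ℝ := fun k => ((if k = j then 2 else 0) - p j - q j) / (q j - p j)
  have hf : ∀ w ∈ simplex b, ∑ k, f k * w k = (2 * w j - p j - q j) / (q j - p j) := by
    intro w hw
    have : ∀ k, f k * w k = (2 * (if k = j then w k else 0) - (p j + q j) * w k) / (q j - p j) := by
      intro k
      simp only [f]
      split_ifs <;> ring
    simp_rw [this]
    rw [← Finset.sum_div, Finset.sum_sub_distrib, ← Finset.mul_sum, ← Finset.mul_sum, hw.2]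
    simp
    ring
  let F : (Fin b → ℝ) → ℝ := fun w => (2 * w j - p j - q j) / (q j - p j)
  have hFp : F p = -1 := by simp only [F]; field_simp; ring
  have hFq : F q = 1 := by simp only [F]; field_simp; ring
  have hF1 : ∀ w ∈ Θ, F w ≤ 1 := by
    intro w hw; simp only [F]; rw [div_le_one hpq]; linarith [hmax w hw]
  have hF2 : ∀ w ∈ Θ, -1 ≤ F w := by
    intro w hw; simp only [F]; rw [le_div_iff₀ hpq]; linarith [hmin w hw]
  let i0 : Fin a := ⟨0, by omega⟩
  let i1 : Fin a := ⟨1, by omega⟩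
  have hi : i0 ≠ i1 := by simp [i0, i1]
  let A : Matrix (Fin a) (Fin b) ℝ :=
    fun i j => ν + (μ - ν) * ((if i = i0 then 2 else 0) - 1) * f j
  have hpay : ∀ x ∈ simplex a, ∀ w ∈ Θ, pay A x w = ν + (μ - ν) * (2 * x i0 - 1) * F w := by
    intro x hx w hw
    rw [← show _ = F w from hf w (hsub hw)]
    exact pay_aux i0 f μ ν x hx w (hsub hw)
  have hx1 : ∀ x ∈ simplex a, x i0 ≤ 1 := by
    intro x hx
    rw [← hx.2]
    exact Finset.single_le_sum (fun i _ => hx.1 i) (Finset.mem_univ i0)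
  have habs : ∀ x ∈ simplex a, ∀ w ∈ Θ, |pay A x w| ≤ μ := by
    intro x hx w hw
    rw [hpay x hx w hw]
    have h1 : |(2 * x i0 - 1) * F w| ≤ 1 := by
      rw [abs_mul]
      apply mul_le_one₀ _ (abs_nonneg _)
      · exact abs_le.2 ⟨hF2 w hw, hF1 w hw⟩
      · exact abs_le.2 ⟨by linarith [hx.1 i0], by linarith [hx1 x hx]⟩
    obtain ⟨h2, h3⟩ := abs_le.1 h1
    rw [mul_assoc]
    exact abs_le.2 ⟨by nlinarith, by nlinarith⟩
  have hsing : ∀ i : Fin a, (Pi.single i 1 : Fin a → ℝ) ∈ simplex a := by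
    intro i
    refine ⟨fun k => ?_, by simp⟩
    by_cases h : k = i
    · subst h; simp
    · simp [h]
  have hbdd : ∀ w ∈ Θ, BddAbove {v | ∃ x ∈ simplex a, v = pay A x w} := by
    intro w hw
    refine ⟨μ, ?_⟩
    rintro v ⟨x, hx, rfl⟩
    exact (abs_le.1 (habs x hx w hw)).2
  have hbr : ∀ w ∈ Θ, ∀ x ∈ simplex a, pay A x w ≤ br A w :=
    fun w hw x hx => le_csSup (hbdd w hw) ⟨x, hx, rfl⟩
  have hbr0 : ∀ w ∈ Θ, ν + (μ - ν) * F w ≤ br A w := by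
    intro w hw
    have := hbr w hw _ (hsing i0)
    rw [hpay _ (hsing i0) w hw] at this
    simp at this
    linarith
  have hbr1 : ∀ w ∈ Θ, ν - (μ - ν) * F w ≤ br A w := by
    intro w hw
    have := hbr w hw _ (hsing i1)
    rw [hpay _ (hsing i1) w hw] at this
    simp [hi] at this
    linarith
  have hμ0 : 0 ≤ μ := hν0.trans hνμ
  have hbrle : ∀ w ∈ Θ, br A w ≤ μ := by
    intro w hw
    apply Real.sSup_le _ hμ0
    rintro v ⟨x, hx, rfl⟩
    exact (abs_le.1 (habs x hx w hw)).2
  refine ⟨A, ?_, ?_, ?_⟩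
  · apply Real.sSup_le _ hμ0
    rintro v ⟨w, hw, x, hx, rfl⟩
    exact habs x hx w hw
  · apply le_csInf
    · exact ⟨_, y, hy, rfl⟩
    · rintro v ⟨w, hw, rfl⟩
      linarith [hbr0 w hw, hbr1 w hw]
  · intro lam hl0 hl1 π hπ hgap
    have hG : ∀ ε, ∀ v ∈ {v | ∃ ystar ∈ Θ, ∃ yhat ∈ convexHull ℝ Θ, l1 yhat ystar ≤ ε ∧
        v = br A ystar - pay A (π yhat) ystar}, v ≤ 2 * μ := by
      rintro ε v ⟨s, hs, t, ht, -, rfl⟩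
      linarith [hbrle s hs, (abs_le.1 (habs _ (hπ t ht) s hs)).1]
    have hpc : p ∈ convexHull ℝ Θ := subset_convexHull ℝ Θ hp
    have g0 : br A p - pay A (π p) p ≤ gap Θ A π 0 :=
      le_csSup ⟨_, hG 0⟩ ⟨p, hp, p, hpc, by simp [l1], rfl⟩
    have g1 : br A q - pay A (π p) q ≤ gap Θ A π (|l1 p q| + 1) :=
      le_csSup ⟨_, hG _⟩ ⟨q, hq, p, hpc, by linarith [le_abs_self (l1 p q)], rfl⟩
    have g2 : gap Θ A π (|l1 p q| + 1) ≤ risk Θ A π := by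
      refine le_csSup ⟨2 * μ, ?_⟩ ⟨_, by positivity, rfl⟩
      rintro v ⟨ε, -, rfl⟩
      exact Real.sSup_le (hG ε) (by linarith)
    rw [hpay _ (hπ p hpc) p hp, hFp] at g0
    rw [hpay _ (hπ p hpc) q hq, hFq] at g1
    have b0 := hbr1 p hp
    have b1 := hbr0 q hq
    rw [hFp] at b0
    rw [hFq] at b1
    have k1 : (kappa Θ * μ - ν) * (1 + lam) ≤ (μ - ν) * (1 + lam) := by
      apply mul_le_mul_of_nonneg_right _ (by linarith)
      nlinarith
    nlinarith
end
end

section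
/- Suppose Θ = P_b, the payoff matrix A ∈ ℝ^{a×b} satisfies ‖A‖_max ≤ α (every entry has absolute value at most α), and the game is fair, i.e. min_{y∈P_b} max_{x∈P_a} xᵀAy = 0. Then for every λ ∈ [0,1] there exists a strategy π : P_b → P_a with Δ(0;π) ≤ (1−λ)α and with risk at most (1+λ)α. -/
open Finset

noncomputable section

lemma simplex_eq (n : ℕ) : simplex n = stdSimplex ℝ (Fin n) := rfl

lemma simplex_ne {n : ℕ} (hn : 0 < n) : (simplex n).Nonempty :=
  ⟨_, single_mem_stdSimplex ℝ (⟨0, hn⟩ : Fin n)⟩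

lemma pay_comb {a b : ℕ} (A : Matrix (Fin a) (Fin b) ℝ) (s t : ℝ) (x x' : Fin a → ℝ)
    (y : Fin b → ℝ) : pay A (s • x + t • x') y = s * pay A x y + t * pay A x' y := by
  simp only [pay, Finset.mul_sum, ← Finset.sum_add_distrib]
  refine Finset.sum_congr rfl fun i _ => Finset.sum_congr rfl fun j _ => ?_
  simp only [Pi.add_apply, Pi.smul_apply, smul_eq_mul]; ring

lemma pay_comb_right {a b : ℕ} (A : Matrix (Fin a) (Fin b) ℝ) (s t : ℝ) (x : Fin a → ℝ)
    (y y' : Fin b → ℝ) : pay A x (s • y + t • y') = s * pay A x y + t * pay A x y' := by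
  simp only [pay, Finset.mul_sum, ← Finset.sum_add_distrib]
  refine Finset.sum_congr rfl fun i _ => Finset.sum_congr rfl fun j _ => ?_
  simp only [Pi.add_apply, Pi.smul_apply, smul_eq_mul]; ring

lemma pay_abs {a b : ℕ} (A : Matrix (Fin a) (Fin b) ℝ) (α : ℝ) (hA : ∀ i j, |A i j| ≤ α)
    {x : Fin a → ℝ} {y : Fin b → ℝ} (hx : x ∈ simplex a) (hy : y ∈ simplex b) :
    |pay A x y| ≤ α := by
  calc |pay A x y| ≤ ∑ i, ∑ j, x i * α * y j := by
        refine (Finset.abs_sum_le_sum_abs _ _).trans (Finset.sum_le_sum fun i _ => ?_)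
        refine (Finset.abs_sum_le_sum_abs _ _).trans (Finset.sum_le_sum fun j _ => ?_)
        rw [abs_mul, abs_mul, abs_of_nonneg (hx.1 i), abs_of_nonneg (hy.1 j)]
        exact mul_le_mul_of_nonneg_right (mul_le_mul_of_nonneg_left (hA i j) (hx.1 i)) (hy.1 j)
    _ = α := by
        simp only [← Finset.mul_sum, hy.2, mul_one, ← Finset.sum_mul, hx.2, one_mul]

lemma cont_left {a b : ℕ} (A : Matrix (Fin a) (Fin b) ℝ) (y : Fin b → ℝ) :
    Continuous fun x => pay A x y := by
  unfold pay; fun_prop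

lemma cont_right {a b : ℕ} (A : Matrix (Fin a) (Fin b) ℝ) (x : Fin a → ℝ) :
    Continuous fun y => pay A x y := by
  unfold pay; fun_prop

lemma exists_br {a b : ℕ} (ha : 0 < a) (A : Matrix (Fin a) (Fin b) ℝ) (y : Fin b → ℝ) :
    ∃ x ∈ simplex a, br A y = pay A x y := by
  obtain ⟨x, hx, hm⟩ := (isCompact_stdSimplex ℝ (Fin a)).exists_isMaxOn (simplex_ne ha)
    (cont_left A y).continuousOn
  refine ⟨x, hx, ?_⟩
  have : IsGreatest {v | ∃ x ∈ simplex a, v = pay A x y} (pay A x y) := by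
    refine ⟨⟨x, hx, rfl⟩, ?_⟩
    rintro v ⟨x', hx', rfl⟩
    exact hm hx'
  exact this.csSup_eq

lemma exists_safe {a b : ℕ} (ha : 0 < a) (hb : 0 < b) (A : Matrix (Fin a) (Fin b) ℝ)
    (α : ℝ) (hA : ∀ i j, |A i j| ≤ α) (hfair : nuTheta (simplex b) A = 0) :
    ∃ x ∈ simplex a, ∀ y ∈ simplex b, 0 ≤ pay A x y := by
  have cb := convex_stdSimplex ℝ (Fin b)
  have ca := convex_stdSimplex ℝ (Fin a)
  obtain ⟨y0, hy0, x0, hx0, h⟩ := Sion.exists_isSaddlePointOn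
    (X := simplex b) (Y := simplex a) (f := fun y x => pay A x y)
    (simplex_ne hb) cb (isCompact_stdSimplex ℝ (Fin b))
    (fun x _ => (cont_right A x).lowerSemicontinuous.lowerSemicontinuousOn _)
    (fun x _ => ConvexOn.quasiconvexOn ⟨cb, fun y _ y' _ s t _ _ _ => by
      simp only [pay_comb_right, smul_eq_mul, le_refl]⟩)
    ca (simplex_ne ha) (isCompact_stdSimplex ℝ (Fin a))
    (fun y _ => (cont_left A y).upperSemicontinuous.upperSemicontinuousOn _)
    (fun y _ => ConcaveOn.quasiconcaveOn ⟨ca, fun y _ y' _ s t _ _ _ => by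
      simp only [pay_comb, smul_eq_mul, le_refl]⟩)
  refine ⟨x0, hx0, fun y hy => ?_⟩
  obtain ⟨x1, hx1, e⟩ := exists_br ha A y0
  have h1 : pay A x1 y0 ≤ pay A x0 y := h y hy x1 hx1
  have h2 : nuTheta (simplex b) A ≤ br A y0 := by
    refine csInf_le ⟨-α, ?_⟩ ⟨y0, hy0, rfl⟩
    rintro v ⟨z, hz, rfl⟩
    obtain ⟨x, hx, e⟩ := exists_br ha A z
    rw [e]
    exact (abs_le.1 (pay_abs A α hA hx hz)).1
  linarith

/-- **Corollary (NFG Pareto Optimality, existence half).** For `Θ = P_b`, a payoff matrix with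
`‖A‖_max ≤ α` in a fair game (`min_{y∈P_b} max_{x∈P_a} xᵀAy = 0`), every `λ ∈ [0,1]` admits a
strategy missing at most `(1−λ)α` opportunity with risk at most `(1+λ)α`. -/
theorem nfg_pareto_existence {a b : ℕ} (ha : 0 < a) (hb : 0 < b)
    (A : Matrix (Fin a) (Fin b) ℝ) (α : ℝ) (hA : ∀ i j, |A i j| ≤ α)
    (hfair : nuTheta (simplex b) A = 0)
    (lam : ℝ) (hlam0 : 0 ≤ lam) (hlam1 : lam ≤ 1) :
    ∃ π : (Fin b → ℝ) → (Fin a → ℝ),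
      (∀ yhat ∈ simplex b, π yhat ∈ simplex a) ∧
      gap (simplex b) A π 0 ≤ (1 - lam) * α ∧
      risk (simplex b) A π ≤ (1 + lam) * α := by
  have hα : 0 ≤ α := (abs_nonneg _).trans (hA ⟨0, ha⟩ ⟨0, hb⟩)
  obtain ⟨x0, hx0, hsafe⟩ := exists_safe ha hb A α hA hfair
  choose xs hxs hbr using exists_br ha A
  have hbrα : ∀ y ∈ simplex b, br A y ≤ α := fun y hy => by
    rw [hbr]; exact (abs_le.1 (pay_abs A α hA (hxs y) hy)).2
  have h1l : 0 ≤ 1 - lam := by linarith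
  refine ⟨fun y => (1 - lam) • x0 + lam • xs y, ?_, ?_, ?_⟩
  · intro y _
    exact convex_stdSimplex ℝ (Fin a) hx0 (hxs y) h1l hlam0 (by ring)
  · refine Real.sSup_le ?_ (mul_nonneg h1l hα)
    rintro v ⟨y, hy, z, hz, hl, rfl⟩
    have hyz : z = y := by
      have h0 : ∑ j, |z j - y j| = 0 := le_antisymm hl (Finset.sum_nonneg fun _ _ => abs_nonneg _)
      rw [Finset.sum_eq_zero_iff_of_nonneg (fun _ _ => abs_nonneg _)] at h0
      funext j
      exact sub_eq_zero.1 (abs_eq_zero.1 (h0 j (Finset.mem_univ j)))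
    subst hyz
    rw [pay_comb, ← hbr]
    have h1 := mul_nonneg h1l (hsafe z hy)
    have h2 := mul_le_mul_of_nonneg_left (hbrα z hy) h1l
    linarith
  · have hr : 0 ≤ (1 + lam) * α := mul_nonneg (by linarith) hα
    refine Real.sSup_le ?_ hr
    rintro v ⟨ε, -, rfl⟩
    refine Real.sSup_le ?_ hr
    rintro v ⟨y, hy, z, hz, -, rfl⟩
    rw [pay_comb]
    have h1 := mul_nonneg h1l (hsafe y hy)
    have h2 := mul_le_mul_of_nonneg_left (abs_le.1 (pay_abs A α hA (hxs z) hy)).1 hlam0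
    have h3 := hbrα y hy
    linarith
end
end

section
/- Let a ≥ 2, b ≥ 2 and α ≥ 0, and take Θ = P_b. There exists a payoff matrix A ∈ ℝ^{a×b} with ‖A‖_max ≤ α such that for every λ ∈ [0,1] and every strategy π : P_b → P_a, if Δ(0;π) ≤ (1−λ)α then the risk of π is at least (1+λ)α. -/
open Finset

noncomputable section

theorem aux_pay_abs {a b : ℕ} (A : Matrix (Fin a) (Fin b) ℝ) (α : ℝ) (hA : ∀ i j, |A i j| ≤ α)
    (x : Fin a → ℝ) (y : Fin b → ℝ) (hx : x ∈ simplex a) (hy : y ∈ simplex b) :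
    |pay A x y| ≤ α := by
  have h1 : |pay A x y| ≤ ∑ i, ∑ j, x i * α * y j := by
    unfold pay
    refine (Finset.abs_sum_le_sum_abs _ _).trans (Finset.sum_le_sum fun i _ => ?_)
    refine (Finset.abs_sum_le_sum_abs _ _).trans (Finset.sum_le_sum fun j _ => ?_)
    rw [abs_mul, abs_mul, abs_of_nonneg (hx.1 i), abs_of_nonneg (hy.1 j)]
    exact mul_le_mul_of_nonneg_right (mul_le_mul_of_nonneg_left (hA i j) (hx.1 i)) (hy.1 j)
  have h2 : ∑ i, ∑ j, x i * α * y j = α := by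
    simp_rw [← Finset.mul_sum, hy.2, mul_one, ← Finset.sum_mul, hx.2, one_mul]
  linarith

theorem aux_hull (b : ℕ) : convexHull ℝ (simplex b) = simplex b :=
  (convex_stdSimplex ℝ (Fin b)).convexHull_eq

theorem aux_single {n : ℕ} (k : Fin n) : (Pi.single k 1 : Fin n → ℝ) ∈ simplex n := by
  constructor
  · intro i
    by_cases h : i = k
    · subst h; simp
    · simp [h]
  · simp

theorem aux_pay_single {a b : ℕ} (A : Matrix (Fin a) (Fin b) ℝ) (x : Fin a → ℝ) (k : Fin b) :
    pay A x (Pi.single k 1) = ∑ i, x i * A i k := by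
  unfold pay
  refine Finset.sum_congr rfl fun i _ => ?_
  rw [Finset.sum_eq_single k]
  · simp
  · intro j _ h
    simp [h]
  · simp

theorem aux_pay_single2 {a b : ℕ} (A : Matrix (Fin a) (Fin b) ℝ) (l : Fin a) (k : Fin b) :
    pay A (Pi.single l 1) (Pi.single k 1) = A l k := by
  rw [aux_pay_single, Finset.sum_eq_single l]
  · simp
  · intro j _ h
    simp [h]
  · simp

theorem aux_br_le {a b : ℕ} (A : Matrix (Fin a) (Fin b) ℝ) (α : ℝ) (hα : 0 ≤ α)
    (hA : ∀ i j, |A i j| ≤ α) (y : Fin b → ℝ) (hy : y ∈ simplex b) : br A y ≤ α := by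
  apply Real.sSup_le _ hα
  rintro v ⟨x, hx, rfl⟩
  exact (abs_le.1 (aux_pay_abs A α hA x y hx hy)).2

theorem aux_le_br {a b : ℕ} (A : Matrix (Fin a) (Fin b) ℝ) (α : ℝ)
    (hA : ∀ i j, |A i j| ≤ α) (y : Fin b → ℝ) (hy : y ∈ simplex b)
    (x : Fin a → ℝ) (hx : x ∈ simplex a) : pay A x y ≤ br A y := by
  apply le_csSup
  · refine ⟨α, ?_⟩
    rintro v ⟨x, hx, rfl⟩
    exact (abs_le.1 (aux_pay_abs A α hA x y hx hy)).2
  · exact ⟨x, hx, rfl⟩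

/-- **Corollary (NFG Pareto Optimality, impossibility half).** For `a ≥ 2`, `b ≥ 2`, `α ≥ 0` and
`Θ = P_b`, there is a payoff matrix `A` with `‖A‖_max ≤ α` such that for every `λ ∈ [0,1]`, any
strategy missing at most `(1−λ)α` opportunity incurs at least `(1+λ)α` risk. -/
theorem nfg_pareto_impossibility {a b : ℕ} (ha : 2 ≤ a) (hb : 2 ≤ b)
    (α : ℝ) (hα : 0 ≤ α) :
    ∃ A : Matrix (Fin a) (Fin b) ℝ, (∀ i j, |A i j| ≤ α) ∧
      ∀ lam : ℝ, 0 ≤ lam → lam ≤ 1 →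
        ∀ π : (Fin b → ℝ) → (Fin a → ℝ),
          (∀ yhat ∈ simplex b, π yhat ∈ simplex a) →
          gap (simplex b) A π 0 ≤ (1 - lam) * α →
          (1 + lam) * α ≤ risk (simplex b) A π := by
  classical
  let i0 : Fin a := ⟨0, by omega⟩
  let i1 : Fin a := ⟨1, by omega⟩
  let j0 : Fin b := ⟨0, by omega⟩
  let j1 : Fin b := ⟨1, by omega⟩
  have hi : i1 ≠ i0 := by simp [i0, i1]
  have hj : j1 ≠ j0 := by simp [j0, j1]
  let A : Matrix (Fin a) (Fin b) ℝ := fun i j => if (i = i0 ↔ j = j0) then α else -α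
  have hA : ∀ i j, |A i j| ≤ α := by
    intro i j
    simp only [A]
    split_ifs
    · rw [abs_of_nonneg hα]
    · rw [abs_neg, abs_of_nonneg hα]
  refine ⟨A, hA, ?_⟩
  intro lam h0 h1 π hπ hgap
  have hub : ∀ ε : ℝ, ∀ v ∈ {v | ∃ ystar ∈ simplex b, ∃ yhat ∈ convexHull ℝ (simplex b),
      l1 yhat ystar ≤ ε ∧ v = br A ystar - pay A (π yhat) ystar}, v ≤ 2 * α := by
    rintro ε v ⟨ys, hys, yh, hyh, -, rfl⟩
    rw [aux_hull] at hyh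
    have := aux_br_le A α hα hA ys hys
    have := (abs_le.1 (aux_pay_abs A α hA _ ys (hπ yh hyh) hys)).1
    linarith
  have hle : ∀ ε : ℝ, ∀ ys ∈ simplex b, ∀ yh ∈ simplex b, l1 yh ys ≤ ε →
      br A ys - pay A (π yh) ys ≤ gap (simplex b) A π ε := by
    intro ε ys hys yh hyh hl
    exact le_csSup ⟨2 * α, hub ε⟩ ⟨ys, hys, yh, by rw [aux_hull]; exact hyh, hl, rfl⟩
  have hgr : ∀ ε : ℝ, 0 < ε → gap (simplex b) A π ε ≤ risk (simplex b) A π := by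
    intro ε hε
    refine le_csSup ⟨2 * α, ?_⟩ ⟨ε, hε, rfl⟩
    rintro v ⟨ε', -, rfl⟩
    exact Real.sSup_le (hub ε') (by linarith)
  set e0 : Fin b → ℝ := Pi.single j0 1 with he0
  set e1 : Fin b → ℝ := Pi.single j1 1 with he1
  have m0 : e0 ∈ simplex b := aux_single j0
  have m1 : e1 ∈ simplex b := aux_single j1
  have g0 := hle 0 e0 m0 e0 m0 (by simp [l1])
  have g1 := hle (l1 e0 e1 + 1) e1 m1 e0 m0 (by linarith)
  have hpos : 0 < l1 e0 e1 + 1 := by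
    have : 0 ≤ l1 e0 e1 := Finset.sum_nonneg fun _ _ => abs_nonneg _
    linarith
  have g2 := hgr _ hpos
  have a0 : A i0 j0 = α := by simp [A]
  have a1 : A i1 j1 = α := by simp [A, hi, hj]
  have b0 : α ≤ br A e0 := by
    have := aux_le_br A α hA e0 m0 (Pi.single i0 1) (aux_single i0)
    rwa [aux_pay_single2, a0] at this
  have b1 : α ≤ br A e1 := by
    have := aux_le_br A α hA e1 m1 (Pi.single i1 1) (aux_single i1)
    rwa [aux_pay_single2, a1] at this
  have hsum : ∀ x, pay A x e0 + pay A x e1 = 0 := by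
    intro x
    rw [he0, he1, aux_pay_single, aux_pay_single, ← Finset.sum_add_distrib]
    refine Finset.sum_eq_zero fun i _ => ?_
    by_cases h : i = i0 <;> simp [A, h, hj]
  have := hsum (π e0)
  linarith
end
end

section
/- In the matching pennies game, for every strategy π : [0,1] → [0,1] and every λ ∈ [0,1]: if Δ_MP(0;π) ≤ 1−λ, then Δ_MP(1;π) ≥ 1+λ. In other words, any strategy missing at most 1−λ opportunity incurs at least 1+λ risk. -/
noncomputable section

/-- Matching-pennies payoff gap
`Δ_MP(ε;π) = sup{ |2y*−1| − (2y*−1)(2π(y)−1) : y, y* ∈ [0,1], |y − y*| ≤ ε }`. -/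
def mpGap (π : ℝ → ℝ) (ε : ℝ) : ℝ :=
  sSup {v | ∃ y ∈ Set.Icc (0:ℝ) 1, ∃ ystar ∈ Set.Icc (0:ℝ) 1, |y - ystar| ≤ ε ∧
    v = |2 * ystar - 1| - (2 * ystar - 1) * (2 * π y - 1)}

/-- **Matching pennies impossibility.** Any strategy `π : [0,1] → [0,1]` with
`Δ_MP(0;π) ≤ 1−λ` satisfies `Δ_MP(1;π) ≥ 1+λ`. -/
theorem mp_impossibility (π : ℝ → ℝ) (hπ : ∀ y ∈ Set.Icc (0:ℝ) 1, π y ∈ Set.Icc (0:ℝ) 1)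
    (lam : ℝ) (hlam0 : 0 ≤ lam) (hlam1 : lam ≤ 1)
    (hopp : mpGap π 0 ≤ 1 - lam) :
    1 + lam ≤ mpGap π 1 := by
  have hb : ∀ ε : ℝ, BddAbove {v | ∃ y ∈ Set.Icc (0:ℝ) 1, ∃ ystar ∈ Set.Icc (0:ℝ) 1,
      |y - ystar| ≤ ε ∧ v = |2 * ystar - 1| - (2 * ystar - 1) * (2 * π y - 1)} := by
    intro ε
    refine ⟨2, ?_⟩
    rintro v ⟨y, hy, z, ⟨hz0, hz1⟩, -, rfl⟩
    obtain ⟨h0, h1⟩ := hπ y hy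
    rcases abs_cases (2 * z - 1) with ⟨h, _⟩ | ⟨h, _⟩ <;> rw [h] <;> nlinarith
  have h1 : 2 - 2 * π 1 ≤ mpGap π 0 := by
    apply le_csSup (hb 0)
    refine ⟨1, by simp, 1, by simp, by simp, ?_⟩
    norm_num
    ring
  have h2 : 2 * π 1 ≤ mpGap π 1 := by
    apply le_csSup (hb 1)
    refine ⟨1, by simp, 0, by simp, by simp, ?_⟩
    norm_num
  linarith
end
end

section
/- In the matching pennies game, for every λ ∈ [0,1] the strategy π_λ(y) = λ·BR(y) + (1−λ)/2, where BR(y) = 1 if y ≥ 1/2 and BR(y) = 0 if y < 1/2, satisfies Δ_MP(0;π_λ) ≤ 1−λ and Δ_MP(ε;π_λ) ≤ 1+λ for every ε ∈ [0,1]. Thus there is a strategy missing at most 1−λ opportunity whose risk is at most 1+λ. -/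
noncomputable section

/-- Best-response probability of Heads: `BR(y) = 1` if `y ≥ 1/2`, else `0`. -/
def mpBR (y : ℝ) : ℝ := if y < 1/2 then 0 else 1

/-- **Matching pennies existence.** For every `λ ∈ [0,1]` the strategy
`π_λ(y) = λ·BR(y) + (1−λ)/2` misses at most `1−λ` opportunity and satisfies
`Δ_MP(ε;π_λ) ≤ 1+λ` for every `ε ∈ [0,1]`. -/
theorem mp_existence (lam : ℝ) (hlam0 : 0 ≤ lam) (hlam1 : lam ≤ 1) :
    mpGap (fun y => lam * mpBR y + (1 - lam) / 2) 0 ≤ 1 - lam ∧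
    ∀ ε : ℝ, 0 ≤ ε → ε ≤ 1 →
      mpGap (fun y => lam * mpBR y + (1 - lam) / 2) ε ≤ 1 + lam := by
  constructor
  · unfold mpGap
    refine Real.sSup_le ?_ (by linarith)
    rintro v ⟨y, ⟨hy0, hy1⟩, z, ⟨hz0, hz1⟩, h, rfl⟩
    have hyz : y = z := by
      have := abs_nonpos_iff.mp h
      linarith
    subst hyz
    simp only [mpBR]
    split_ifs with hc
    · rw [abs_of_nonpos (by linarith)]
      nlinarith
    · rw [abs_of_nonneg (by linarith)]
      nlinarith
  · intro ε _ _
    unfold mpGap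
    refine Real.sSup_le ?_ (by linarith)
    rintro v ⟨y, ⟨hy0, hy1⟩, z, ⟨hz0, hz1⟩, h, rfl⟩
    simp only [mpBR]
    split_ifs with hc <;> rcases abs_cases (2 * z - 1) with ⟨h1, h2⟩ | ⟨h1, h2⟩ <;> rw [h1] <;> nlinarith
end
end

section
/- (Lemma 1, Bound 1.) Fix a state s. Let π, π* be probability distributions on 𝒜, let σ, σ̃, σ̄ be probability distributions on ℬ, let V*, Ṽ, V̄ : S → ℝ be arbitrary functions, and let λ ∈ [0,1], γ ∈ [0,1), ε ≥ 0, η ≥ 0. Assume (i) |r(s,a,a')| ≤ r_max for all a, a'; (ii) ‖σ − σ̃‖₁ ≤ ε; (iii) |V*(s') − Ṽ(s')| ≤ η for all s' ∈ S; and (iv) the argmax property λ(E_{π,σ̃}[r](s) + γE_{p,π,σ̃}[Ṽ](s)) + (1−λ)(E_{π,σ̄}[r](s) + γE_{p,π,σ̄}[V̄](s)) ≥ λ(E_{π*,σ̃}[r](s) + γE_{p,π*,σ̃}[Ṽ](s)) + (1−λ)(E_{π*,σ̄}[r](s) + γE_{p,π*,σ̄}[V̄](s)). Then E_{π*,σ}[r](s)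 − E_{π,σ}[r](s) ≤ γλ(E_{p,π,σ̃}[V*](s) − E_{p,π*,σ̃}[V*](s)) + 2λ(ε r_max + γη) + γ(1−λ)(E_{p,π,σ̄}[V̄](s) − E_{p,π*,σ̄}[V̄](s)) + (1−λ)(E_{π*,σ}[r](s) − E_{π*,σ̄}[r](s)) + (1−λ)(E_{π,σ̄}[r](s) − E_{π,σ}[r](s)). -/
open Finset

noncomputable section

/-- `x` is a probability distribution on the finite type `α`. -/
def IsProb {α : Type*} [Fintype α] (x : α → ℝ) : Prop :=
  (∀ i, 0 ≤ x i) ∧ ∑ i, x i = 1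

/-- Expected one-step reward `E_{x,ς}[r](s) = Σ_{a,a'} x(a) ς(a') r(s,a,a')`. -/
def Er {S A B : Type*} [Fintype A] [Fintype B]
    (r : S → A → B → ℝ) (x : A → ℝ) (ς : B → ℝ) (s : S) : ℝ :=
  ∑ a, ∑ a', x a * ς a' * r s a a'

/-- Expected next-state value
`E_{p,x,ς}[V](s) = Σ_{a,a',s'} x(a) ς(a') p(s'|s,a,a') V(s')`. -/
def Ep {S A B : Type*} [Fintype S] [Fintype A] [Fintype B]
    (p : S → A → B → S → ℝ) (x : A → ℝ) (ς : B → ℝ) (V : S → ℝ) (s : S) : ℝ :=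
  ∑ a, ∑ a', ∑ s', x a * ς a' * p s a a' s' * V s'

theorem Er_close {S A B : Type*} [Fintype A] [Fintype B]
    (r : S → A → B → ℝ) (rmax : ℝ) (s : S) (x : A → ℝ) (hx : IsProb x)
    (σ σt : B → ℝ) (ε : ℝ) (hσ : IsProb σ)
    (hr : ∀ a a', |r s a a'| ≤ rmax)
    (hσε : ∑ a', |σ a' - σt a'| ≤ ε) :
    |Er r x σ s - Er r x σt s| ≤ ε * rmax := by
  have hA : Nonempty A := by
    by_contra h
    rw [not_nonempty_iff] at h
    have := hx.2
    simp at this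
  have hB : Nonempty B := by
    by_contra h
    rw [not_nonempty_iff] at h
    have := hσ.2
    simp at this
  obtain ⟨a0⟩ := hA
  obtain ⟨b0⟩ := hB
  have hr0 : 0 ≤ rmax := (abs_nonneg _).trans (hr a0 b0)
  have e : Er r x σ s - Er r x σt s = ∑ a, x a * ∑ a', (σ a' - σt a') * r s a a' := by
    unfold Er
    rw [← Finset.sum_sub_distrib]
    refine Finset.sum_congr rfl fun a _ => ?_
    rw [← Finset.sum_sub_distrib, Finset.mul_sum]
    exact Finset.sum_congr rfl fun b _ => by ring
  rw [e]
  calc _ ≤ ∑ a, |x a * ∑ a', (σ a' - σt a') * r s a a'| := Finset.abs_sum_le_sum_abs _ _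
    _ ≤ ∑ a, x a * (ε * rmax) := by
        refine Finset.sum_le_sum fun a _ => ?_
        rw [abs_mul, abs_of_nonneg (hx.1 a)]
        refine mul_le_mul_of_nonneg_left ?_ (hx.1 a)
        calc _ ≤ ∑ a', |(σ a' - σt a') * r s a a'| := Finset.abs_sum_le_sum_abs _ _
          _ ≤ ∑ a', |σ a' - σt a'| * rmax := by
              refine Finset.sum_le_sum fun b _ => ?_
              rw [abs_mul]
              exact mul_le_mul_of_nonneg_left (hr a b) (abs_nonneg _)
          _ = (∑ a', |σ a' - σt a'|) * rmax := by rw [Finset.sum_mul]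
          _ ≤ _ := mul_le_mul_of_nonneg_right hσε hr0
    _ = _ := by rw [← Finset.sum_mul, hx.2, one_mul]

theorem Ep_close {S A B : Type*} [Fintype S] [Fintype A] [Fintype B]
    (p : S → A → B → S → ℝ) (hp0 : ∀ s a a' s', 0 ≤ p s a a' s')
    (hp1 : ∀ s a a', ∑ s', p s a a' s' = 1) (s : S)
    (x : A → ℝ) (hx : IsProb x) (σ : B → ℝ) (hσ : IsProb σ) (V W : S → ℝ) (η : ℝ)
    (hV : ∀ s', |V s' - W s'| ≤ η) :
    |Ep p x σ V s - Ep p x σ W s| ≤ η := by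
  have e : Ep p x σ V s - Ep p x σ W s
      = ∑ a, ∑ a', ∑ s', x a * σ a' * p s a a' s' * (V s' - W s') := by
    unfold Ep
    simp only [← Finset.sum_sub_distrib, mul_sub]
  have t : ∑ a, ∑ a', ∑ s', x a * σ a' * p s a a' s' * η = η := by
    simp only [← Finset.sum_mul, ← Finset.mul_sum, hp1, hσ.2, hx.2, mul_one, one_mul]
  rw [e]
  refine le_of_le_of_eq ?_ t
  refine (Finset.abs_sum_le_sum_abs _ _).trans (Finset.sum_le_sum fun a _ => ?_)
  refine (Finset.abs_sum_le_sum_abs _ _).trans (Finset.sum_le_sum fun b _ => ?_)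
  refine (Finset.abs_sum_le_sum_abs _ _).trans (Finset.sum_le_sum fun c _ => ?_)
  have h0 : 0 ≤ x a * σ b * p s a b c := mul_nonneg (mul_nonneg (hx.1 a) (hσ.1 b)) (hp0 _ _ _ _)
  rw [abs_mul, abs_of_nonneg h0]
  exact mul_le_mul_of_nonneg_left (hV c) h0

/-- **Lemma 1, Bound 1.** -/
theorem lemma1_bound1 {S A B : Type*} [Fintype S] [Fintype A] [Fintype B]
    (p : S → A → B → S → ℝ) (hp0 : ∀ s a a' s', 0 ≤ p s a a' s')
    (hp1 : ∀ s a a', ∑ s', p s a a' s' = 1)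
    (r : S → A → B → ℝ) (rmax : ℝ) (s : S)
    (π πstar : A → ℝ) (hπ : IsProb π) (hπstar : IsProb πstar)
    (σ σt σb : B → ℝ) (hσ : IsProb σ) (hσt : IsProb σt) (hσb : IsProb σb)
    (Vstar Vt Vb : S → ℝ)
    (lam γ ε η : ℝ) (hlam0 : 0 ≤ lam) (hlam1 : lam ≤ 1) (hγ0 : 0 ≤ γ) (hγ1 : γ < 1)
    (hε : 0 ≤ ε) (hη : 0 ≤ η)
    (hr : ∀ a a', |r s a a'| ≤ rmax)
    (hσε : ∑ a', |σ a' - σt a'| ≤ ε)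
    (hVη : ∀ s' : S, |Vstar s' - Vt s'| ≤ η)
    (hargmax :
      lam * (Er r π σt s + γ * Ep p π σt Vt s) +
        (1 - lam) * (Er r π σb s + γ * Ep p π σb Vb s) ≥
      lam * (Er r πstar σt s + γ * Ep p πstar σt Vt s) +
        (1 - lam) * (Er r πstar σb s + γ * Ep p πstar σb Vb s)) :
    Er r πstar σ s - Er r π σ s ≤
      γ * lam * (Ep p π σt Vstar s - Ep p πstar σt Vstar s) +
        2 * lam * (ε * rmax + γ * η) +
        γ * (1 - lam) * (Ep p π σb Vb s - Ep p πstar σb Vb s) +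
        (1 - lam) * (Er r πstar σ s - Er r πstar σb s) +
        (1 - lam) * (Er r π σb s - Er r π σ s) := by
  have h1 := (abs_le.1 (Er_close r rmax s πstar hπstar σ σt ε hσ hr hσε)).2
  have h2 := (abs_le.1 (Er_close r rmax s π hπ σ σt ε hσ hr hσε)).1
  have h3 := (abs_le.1 (Ep_close p hp0 hp1 s πstar hπstar σt hσt Vstar Vt η hVη)).2
  have h4 := (abs_le.1 (Ep_close p hp0 hp1 s π hπ σt hσt Vstar Vt η hVη)).1
  have hg : 0 ≤ lam * γ := mul_nonneg hlam0 hγ0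
  have k1 := mul_le_mul_of_nonneg_left h1 hlam0
  have k2 := mul_le_mul_of_nonneg_left h2 hlam0
  have k3 := mul_le_mul_of_nonneg_left h3 hg
  have k4 := mul_le_mul_of_nonneg_left h4 hg
  linarith
end
end

section
/- (Lemma 2, strategy bound.) Let λ ∈ [0,1], and let σ, σ̃, σ̄ : S → P_ℬ be opponent strategy kernels with ε = max_s ‖σ(s) − σ̃(s)‖₁. Let V* = V^{*,σ}, Ṽ = V^{*,σ̃}, V̄ = V^{*,σ̄} be the optimal value functions (solutions of the Bellman optimality equations against σ, σ̃, σ̄ respectively), and set η = max_s |V*(s) − Ṽ(s)|. Let π : S → P_𝒜 be a value-based strategy, i.e. for every s and every distribution x on 𝒜, λ(E_{π(s),σ̃(s)}[r](s) + γE_{p,π(s),σ̃(s)}[Ṽ](s)) + (1−λ)(E_{π(s),σ̄(s)}[r](s) + γE_{p,π(s),σ̄(s)}[V̄](s)) ≥ λ(E_{x,σ̃(s)}[r](s) + γE_{p,x,σ̃(s)}[Ṽ](s)) + (1−λ)(E_{x,σ̄(s)}[r](s) + γE_{p,x,σ̄(s)}[V̄](s)). Assume in addition that V̄(s) ≥ ν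 for all s and that V^{π,σ}(s) ≥ V^{π,σ̄}(s) for all s. Then max_s (V^{*,σ}(s) − V^{π,σ}(s)) ≤ (r_max/(1−λγ))·(2λε/(1−γ) + min{2λ/(1−γ)², 2(1−λ)/(1−γ)²} + (1−λ)(2−γ)/(1−γ)) + γ(2λη − (1−λ)ν)/(1−λγ). -/
open Finset

noncomputable section

/-- `V` satisfies the Bellman equation of the pair `(π, σ)`:
`V(s) = E_{π(s),σ(s)}[r](s) + γ E_{p,π(s),σ(s)}[V](s)`. -/
def IsValue {S A B : Type*} [Fintype S] [Fintype A] [Fintype B]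
    (p : S → A → B → S → ℝ) (r : S → A → B → ℝ) (γ : ℝ)
    (π : S → A → ℝ) (σ : S → B → ℝ) (V : S → ℝ) : Prop :=
  ∀ s, V s = Er r (π s) (σ s) s + γ * Ep p (π s) (σ s) V s

/-- `V` satisfies the Bellman optimality equation against the opponent kernel `σ`:
`V(s) = max_{a} Σ_{a'} σ(s)(a') (r(s,a,a') + γ Σ_{s'} p(s'|s,a,a') V(s'))`. -/
def IsOptValue {S A B : Type*} [Fintype S] [Fintype A] [Fintype B] [Nonempty A]
    (p : S → A → B → S → ℝ) (r : S → A → B → ℝ) (γ : ℝ)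
    (σ : S → B → ℝ) (V : S → ℝ) : Prop :=
  ∀ s, V s = Finset.univ.sup' Finset.univ_nonempty (fun a =>
    ∑ a', σ s a' * (r s a a' + γ * ∑ s', p s a a' s' * V s'))


section helpers

variable {S A B : Type*} [Fintype S] [Fintype A] [Fintype B]

/-- one-step lookahead -/
def WW (p : S → A → B → S → ℝ) (r : S → A → B → ℝ) (γ : ℝ) (x : A → ℝ) (ς : B → ℝ)
    (V : S → ℝ) (s : S) : ℝ := Er r x ς s + γ * Ep p x ς V s

lemma WW_eq (p : S → A → B → S → ℝ) (r : S → A → B → ℝ) (γ : ℝ) (x : A → ℝ) (ς : B → ℝ)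
    (V : S → ℝ) (s : S) :
    WW p r γ x ς V s = ∑ a, x a * ∑ a', ς a' * (r s a a' + γ * ∑ s', p s a a' s' * V s') := by
  unfold WW Er Ep
  simp only [Finset.mul_sum, mul_add, Finset.sum_add_distrib]
  congr 1
  · exact Finset.sum_congr rfl fun a _ => Finset.sum_congr rfl fun b _ => by ring
  · exact Finset.sum_congr rfl fun a _ => Finset.sum_congr rfl fun b _ =>
      Finset.sum_congr rfl fun c _ => by ring

lemma avg_le {ι : Type*} [Fintype ι] {x : ι → ℝ} (hx : IsProb x) {f : ι → ℝ} {c : ℝ}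
    (h : ∀ i, f i ≤ c) : ∑ i, x i * f i ≤ c := by
  calc ∑ i, x i * f i ≤ ∑ i, x i * c :=
        Finset.sum_le_sum fun i _ => mul_le_mul_of_nonneg_left (h i) (hx.1 i)
    _ = c := by rw [← Finset.sum_mul, hx.2, one_mul]

lemma le_avg {ι : Type*} [Fintype ι] {x : ι → ℝ} (hx : IsProb x) {f : ι → ℝ} {c : ℝ}
    (h : ∀ i, c ≤ f i) : c ≤ ∑ i, x i * f i := by
  calc c = ∑ i, x i * c := by rw [← Finset.sum_mul, hx.2, one_mul]
    _ ≤ ∑ i, x i * f i :=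
        Finset.sum_le_sum fun i _ => mul_le_mul_of_nonneg_left (h i) (hx.1 i)

variable {p : S → A → B → S → ℝ} {r : S → A → B → ℝ} {γ rmax : ℝ}

lemma WW_ge (hp : ∀ s a a', IsProb (p s a a')) (hr : ∀ s a a', |r s a a'| ≤ rmax)
    (hγ0 : 0 ≤ γ) {x : A → ℝ} {ς : B → ℝ} (hx : IsProb x) (hς : IsProb ς)
    {V : S → ℝ} {c : ℝ} (h : ∀ s, c ≤ V s) (s : S) : -rmax + γ * c ≤ WW p r γ x ς V s := by
  rw [WW_eq]
  refine le_avg hx fun a => le_avg hς fun b => ?_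
  exact add_le_add (abs_le.1 (hr s a b)).1
    (mul_le_mul_of_nonneg_left (le_avg (hp s a b) h) hγ0)

lemma WW_le (hp : ∀ s a a', IsProb (p s a a')) (hr : ∀ s a a', |r s a a'| ≤ rmax)
    (hγ0 : 0 ≤ γ) {x : A → ℝ} {ς : B → ℝ} (hx : IsProb x) (hς : IsProb ς)
    {V : S → ℝ} {c : ℝ} (h : ∀ s, V s ≤ c) (s : S) : WW p r γ x ς V s ≤ rmax + γ * c := by
  rw [WW_eq]
  refine avg_le hx fun a => avg_le hς fun b => ?_
  exact add_le_add (abs_le.1 (hr s a b)).2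
    (mul_le_mul_of_nonneg_left (avg_le (hp s a b) h) hγ0)

lemma WW_mono (hp : ∀ s a a', IsProb (p s a a'))
    (hγ0 : 0 ≤ γ) {x : A → ℝ} {ς : B → ℝ} (hx : IsProb x) (hς : IsProb ς)
    {V V' : S → ℝ} {c : ℝ} (h : ∀ s, V s - V' s ≤ c) (s : S) :
    WW p r γ x ς V s ≤ WW p r γ x ς V' s + γ * c := by
  rw [← sub_le_iff_le_add', WW_eq, WW_eq, ← Finset.sum_sub_distrib]
  simp only [← mul_sub, ← Finset.sum_sub_distrib, add_sub_add_left_eq_sub]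
  exact avg_le hx fun a => avg_le hς fun b =>
    mul_le_mul_of_nonneg_left (avg_le (hp s a b) h) hγ0

lemma WW_eps (hp : ∀ s a a', IsProb (p s a a')) (hr : ∀ s a a', |r s a a'| ≤ rmax)
    (hγ0 : 0 ≤ γ) {x : A → ℝ} {ς ς' : B → ℝ} (hx : IsProb x)
    {V : S → ℝ} {c K e : ℝ} (h : ∀ s, |V s| ≤ c) (hK : rmax + γ * c = K) (hK0 : 0 ≤ K)
    (he : ∑ b, |ς b - ς' b| ≤ e) (s : S) :
    WW p r γ x ς V s ≤ WW p r γ x ς' V s + e * K := by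
  rw [← sub_le_iff_le_add', WW_eq, WW_eq, ← Finset.sum_sub_distrib]
  simp only [← mul_sub, ← Finset.sum_sub_distrib, ← sub_mul]
  refine avg_le hx fun a => ?_
  calc _ ≤ ∑ b, |ς b - ς' b| * K := by
        refine Finset.sum_le_sum fun b _ => ?_
        refine (le_abs_self _).trans ?_
        rw [abs_mul]
        refine mul_le_mul_of_nonneg_left ?_ (abs_nonneg _)
        have h1 := mul_le_mul_of_nonneg_left
          (avg_le (hp s a b) fun s => (abs_le.1 (h s)).2) hγ0
        have h2 := mul_le_mul_of_nonneg_left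
          (le_avg (hp s a b) fun s => (abs_le.1 (h s)).1) hγ0
        have h3 := abs_le.1 (hr s a b)
        rw [abs_le]
        constructor <;> linarith
    _ ≤ e * K := by
        rw [← Finset.sum_mul]
        exact mul_le_mul_of_nonneg_right he hK0

lemma V_bdd (hp : ∀ s a a', IsProb (p s a a')) (hr : ∀ s a a', |r s a a'| ≤ rmax)
    (hγ0 : 0 ≤ γ) (hγ1 : γ < 1) {V : S → ℝ}
    (h : ∀ s, ∃ x ς, IsProb x ∧ IsProb ς ∧ V s = WW p r γ x ς V s) (s : S) :
    |V s| ≤ rmax / (1 - γ) := by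
  haveI : Nonempty S := ⟨s⟩
  obtain ⟨s0, hs0⟩ := Finite.exists_max (fun s => |V s|)
  obtain ⟨x, ς, hx, hς, e⟩ := h s0
  have h1 := WW_le hp hr hγ0 hx hς (fun s => (abs_le.1 (hs0 s)).2) s0
  have h2 := WW_ge hp hr hγ0 hx hς (fun s => (abs_le.1 (hs0 s)).1) s0
  rw [← e] at h1 h2
  have h3 : |V s0| ≤ rmax + γ * |V s0| := abs_le.2 ⟨by linarith, h1⟩
  refine (hs0 s).trans ?_
  rw [le_div_iff₀ (by linarith)]
  linarith

lemma opt_exists [Nonempty A] {σ : S → B → ℝ} {V : S → ℝ} (h : IsOptValue p r γ σ V) (s : S) :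
    ∃ x, IsProb x ∧ V s = WW p r γ x (σ s) V s := by
  classical
  obtain ⟨a, -, ha⟩ := Finset.exists_mem_eq_sup' (Finset.univ_nonempty (α := A)) (fun a =>
    ∑ a', σ s a' * (r s a a' + γ * ∑ s', p s a a' s' * V s'))
  refine ⟨fun i => if i = a then 1 else 0, ⟨fun i => by dsimp only; split_ifs <;> norm_num,
    by simp⟩, ?_⟩
  rw [WW_eq, h s, ha]
  simp

end helpers

/-- **Lemma 2 (strategy bound).** -/
theorem lemma2_strategy_bound {S A B : Type*}
    [Fintype S] [Fintype A] [Fintype B] [Nonempty S] [Nonempty A] [Nonempty B]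
    (p : S → A → B → S → ℝ) (hp0 : ∀ s a a' s', 0 ≤ p s a a' s')
    (hp1 : ∀ s a a', ∑ s', p s a a' s' = 1)
    (r : S → A → B → ℝ) (rmax : ℝ) (hr : ∀ s a a', |r s a a'| ≤ rmax)
    (γ : ℝ) (hγ0 : 0 ≤ γ) (hγ1 : γ < 1)
    (lam : ℝ) (hlam0 : 0 ≤ lam) (hlam1 : lam ≤ 1)
    (σ σt σb : S → B → ℝ) (hσ : ∀ s, IsProb (σ s)) (hσt : ∀ s, IsProb (σt s))
    (hσb : ∀ s, IsProb (σb s))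
    (ε : ℝ) (hε : ε = Finset.univ.sup' Finset.univ_nonempty
      (fun s : S => ∑ a', |σ s a' - σt s a'|))
    (Vstar Vt Vb : S → ℝ)
    (hVstar : IsOptValue p r γ σ Vstar) (hVt : IsOptValue p r γ σt Vt)
    (hVb : IsOptValue p r γ σb Vb)
    (η : ℝ) (hη : η = Finset.univ.sup' Finset.univ_nonempty
      (fun s : S => |Vstar s - Vt s|))
    (ν : ℝ) (hν : ∀ s, ν ≤ Vb s)
    (π : S → A → ℝ) (hπ : ∀ s, IsProb (π s))
    (hvalue_based : ∀ s, ∀ x : A → ℝ, IsProb x →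
      lam * (Er r (π s) (σt s) s + γ * Ep p (π s) (σt s) Vt s) +
        (1 - lam) * (Er r (π s) (σb s) s + γ * Ep p (π s) (σb s) Vb s) ≥
      lam * (Er r x (σt s) s + γ * Ep p x (σt s) Vt s) +
        (1 - lam) * (Er r x (σb s) s + γ * Ep p x (σb s) Vb s))
    (Vπ Vπb : S → ℝ) (hVπ : IsValue p r γ π σ Vπ) (hVπb : IsValue p r γ π σb Vπb)
    (hdom : ∀ s, Vπb s ≤ Vπ s) :
    ∀ s, Vstar s - Vπ s ≤
      rmax / (1 - lam * γ) *
        (2 * lam * ε / (1 - γ) +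
          min (2 * lam / (1 - γ) ^ 2) (2 * (1 - lam) / (1 - γ) ^ 2) +
          (1 - lam) * (2 - γ) / (1 - γ)) +
      γ * (2 * lam * η - (1 - lam) * ν) / (1 - lam * γ) := by
  have hp : ∀ s a a', IsProb (p s a a') := fun s a b => ⟨hp0 s a b, hp1 s a b⟩
  have hR : 0 ≤ rmax := (abs_nonneg _).trans
    (hr (Classical.arbitrary S) (Classical.arbitrary A) (Classical.arbitrary B))
  have hg : 0 < 1 - γ := by linarith
  have hl : 0 ≤ 1 - lam := by linarith
  have hlg : 0 < 1 - lam * γ := by nlinarith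
  obtain ⟨M, hM⟩ : ∃ M, M = rmax / (1 - γ) := ⟨_, rfl⟩
  have hM1 : rmax + γ * M = M := by rw [hM]; field_simp; ring
  have hM0 : 0 ≤ M := hM ▸ div_nonneg hR hg.le
  have os := opt_exists hVstar
  have ot := opt_exists hVt
  have ob := opt_exists hVb
  have bs : ∀ s, |Vstar s| ≤ M := fun s => hM ▸ V_bdd hp hr hγ0 hγ1
    (fun s => let ⟨x, hx, e⟩ := os s; ⟨x, σ s, hx, hσ s, e⟩) s
  have bt : ∀ s, |Vt s| ≤ M := fun s => hM ▸ V_bdd hp hr hγ0 hγ1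
    (fun s => let ⟨x, hx, e⟩ := ot s; ⟨x, σt s, hx, hσt s, e⟩) s
  have bb : ∀ s, |Vb s| ≤ M := fun s => hM ▸ V_bdd hp hr hγ0 hγ1
    (fun s => let ⟨x, hx, e⟩ := ob s; ⟨x, σb s, hx, hσb s, e⟩) s
  have bπb : ∀ s, |Vπb s| ≤ M := fun s => hM ▸ V_bdd hp hr hγ0 hγ1
    (fun s => ⟨π s, σb s, hπ s, hσb s, hVπb s⟩) s
  have he : ∀ s, ∑ b, |σ s b - σt s b| ≤ ε := fun s => by
    rw [hε]; exact Finset.le_sup' (fun s : S => ∑ a', |σ s a' - σt s a'|) (Finset.mem_univ s)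
  have he' : ∀ s, ∑ b, |σt s b - σ s b| ≤ ε := fun s => by
    simpa only [abs_sub_comm] using he s
  have hn : ∀ s, |Vstar s - Vt s| ≤ η := fun s => by
    rw [hη]; exact Finset.le_sup' (fun s : S => |Vstar s - Vt s|) (Finset.mem_univ s)
  have hvb : ∀ s, ∀ x : A → ℝ, IsProb x →
      lam * WW p r γ x (σt s) Vt s + (1 - lam) * WW p r γ x (σb s) Vb s ≤
      lam * WW p r γ (π s) (σt s) Vt s + (1 - lam) * WW p r γ (π s) (σb s) Vb s :=
    fun s x hx => hvalue_based s x hx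
  have eπ : ∀ s, Vπ s = WW p r γ (π s) (σ s) Vπ s := hVπ
  have eπb : ∀ s, Vπb s = WW p r γ (π s) (σb s) Vπb s := hVπb
  -- the gap against σb
  obtain ⟨s1, hs1⟩ := Finite.exists_max (fun s => Vb s - Vπb s)
  obtain ⟨D1, hD1⟩ : ∃ D, D = Vb s1 - Vπb s1 := ⟨_, rfl⟩
  have hs1 : ∀ s, Vb s - Vπb s ≤ D1 := fun s => hD1 ▸ hs1 s
  have k1 : D1 ≤ 2 * M := by
    have := abs_le.1 (bb s1); have := abs_le.1 (bπb s1); linarith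
  have k2 : (1 - lam) * D1 * (1 - γ) ≤ 2 * lam * M := by
    obtain ⟨x, hx, ex⟩ := ob s1
    have h1 := hvb s1 x hx
    have h2 := WW_le hp hr hγ0 (hπ s1) (hσt s1) (fun s => (abs_le.1 (bt s)).2) s1
    have h3 := WW_ge hp hr hγ0 hx (hσt s1) (fun s => (abs_le.1 (bt s)).1) s1
    have h4 := WW_mono (r := r) hp hγ0 (hπ s1) (hσb s1) hs1 s1
    rw [← eπb] at h4
    rw [← ex] at h1
    have h5 := mul_le_mul_of_nonneg_left h4 hl
    have h6 := mul_le_mul_of_nonneg_left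
      (show WW p r γ (π s1) (σt s1) Vt s1 - WW p r γ x (σt s1) Vt s1 ≤ 2 * M by linarith) hlam0
    have h7 : (1 - lam) * D1 = (1 - lam) * Vb s1 - (1 - lam) * Vπb s1 := by rw [hD1]; ring
    linarith
  have hMdiv : M / (1 - γ) = rmax / (1 - γ) ^ 2 := by rw [hM]; field_simp
  have hMle : M ≤ M / (1 - γ) := by
    rw [le_div_iff₀ hg]; nlinarith
  have hD10 : 0 ≤ M / (1 - γ) := div_nonneg hM0 hg.le
  have kk : (1 - lam) * (γ * D1) ≤
      rmax * min (2 * lam / (1 - γ) ^ 2) (2 * (1 - lam) / (1 - γ) ^ 2) := by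
    rw [mul_min_of_nonneg _ _ hR]
    have e1 : rmax * (2 * lam / (1 - γ) ^ 2) = 2 * lam * (M / (1 - γ)) := by rw [hMdiv]; ring
    have e2 : rmax * (2 * (1 - lam) / (1 - γ) ^ 2) = (1 - lam) * (2 * (M / (1 - γ))) := by
      rw [hMdiv]; ring
    rw [e1, e2]
    have g : ∀ y z : ℝ, y ≤ z → 0 ≤ z → γ * y ≤ z := fun y z h1 h2 => by nlinarith
    refine le_min ?_ ?_
    · have : (1 - lam) * D1 ≤ 2 * lam * (M / (1 - γ)) := by
        rw [← mul_div_assoc, le_div_iff₀ hg]; exact k2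
      have := g _ _ this (by positivity)
      linarith
    · exact mul_le_mul_of_nonneg_left (g _ _ (by linarith) (by linarith)) hl
  -- main
  obtain ⟨s0, hs0⟩ := Finite.exists_max (fun s => Vstar s - Vπ s)
  obtain ⟨D, hD⟩ : ∃ D, D = Vstar s0 - Vπ s0 := ⟨_, rfl⟩
  have hs0 : ∀ s, Vstar s - Vπ s ≤ D := fun s => hD ▸ hs0 s
  intro s
  refine (hs0 s).trans ?_
  obtain ⟨x, hx, ex⟩ := os s0
  have a1 := WW_eps hp hr hγ0 hx bs hM1 hM0 (he s0) s0
  have a2 := WW_mono (r := r) hp hγ0 hx (hσt s0) (fun s => (abs_le.1 (hn s)).2) s0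
  have a3 := hvb s0 x hx
  have a4 := WW_mono (r := r) (V := Vt) (V' := Vstar) (c := η) hp hγ0 (hπ s0) (hσt s0)
    (fun s => by have := (abs_le.1 (hn s)).1; linarith) s0
  have a5 := WW_eps hp hr hγ0 (hπ s0) bs hM1 hM0 (he' s0) s0
  have a6 := WW_mono (r := r) hp hγ0 (hπ s0) (hσ s0) hs0 s0
  rw [← eπ] at a6
  rw [← ex] at a1
  have a7 := WW_mono (r := r) hp hγ0 (hπ s0) (hσb s0) hs1 s0
  rw [← eπb] at a7
  have a8 := WW_ge hp hr hγ0 hx (hσb s0) hν s0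
  have a9 := (abs_le.1 (bs s0)).2
  have a10 := hdom s0
  have b1 := mul_le_mul_of_nonneg_left
    (show Vstar s0 - Vπ s0 ≤ WW p r γ x (σt s0) Vt s0 - WW p r γ (π s0) (σt s0) Vt s0
      + (2 * ε * M + 2 * γ * η + γ * D) by linarith) hlam0
  have b2 := mul_le_mul_of_nonneg_left
    (show Vstar s0 - Vπ s0 ≤ M + rmax - γ * ν + γ * D1 - WW p r γ (π s0) (σb s0) Vb s0
      + WW p r γ x (σb s0) Vb s0 by linarith) hl
  rw [← hD] at b1 b2
  have fin : D * (1 - lam * γ) ≤ lam * (2 * ε * M + 2 * γ * η) + (1 - lam) * (M + rmax - γ * ν)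
      + (1 - lam) * (γ * D1) := by linarith
  have hMr : M + rmax = rmax * (2 - γ) / (1 - γ) := by rw [hM]; field_simp; ring
  generalize min (2 * lam / (1 - γ) ^ 2) (2 * (1 - lam) / (1 - γ) ^ 2) = m at kk ⊢
  rw [div_mul_eq_mul_div, ← add_div, le_div_iff₀ hlg]
  refine (fin.trans (add_le_add_right kk _)).trans (le_of_eq ?_)
  rw [add_sub_assoc, ← add_sub_assoc, hMr, hM]
  ring
end
end

section
/- (Theorem 3, risk bound.) Let λ ∈ [0,1] and let σ, σ̃, σ̄ : S → P_ℬ be opponent strategy kernels (the true strategy σ may be arbitrary, so no closeness of σ̃ to σ is assumed). Let V* = V^{*,σ}, Ṽ = V^{*,σ̃}, V̄ = V^{*,σ̄} be the optimal value functions against σ, σ̃, σ̄, and suppose V̄(s) ≥ ν for all s. Let π : S → P_𝒜 be the value-based strategy: for every s and every distribution x on 𝒜, λ(E_{π(s),σ̃(s)}[r](s) + γE_{p,π(s),σ̃(s)}[Ṽ](s)) + (1−λ)(E_{π(s),σ̄(s)}[r](s) + γE_{p,π(s),σ̄(s)}[V̄](s)) ≥ the same expression with x in place of π(s). Assume V^{π,σ}(s)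 ≥ V^{π,σ̄}(s) for all s. Then max_s (V^{*,σ}(s) − V^{π,σ}(s)) ≤ (r_max/(1−λγ))·((4(1−γ²)+2)λ/(1−γ)² + (1−λ)(2−γ)/(1−γ)) − γ(1−λ)ν/(1−λγ). -/
open Finset

noncomputable section

lemma Er_le {S A B : Type*} [Fintype A] [Fintype B]
    (r : S → A → B → ℝ) (c : ℝ) (hr : ∀ s a a', r s a a' ≤ c) (x : A → ℝ) (y : B → ℝ)
    (hx : IsProb x) (hy : IsProb y) (s : S) : Er r x y s ≤ c := by
  have h : ∑ a, ∑ a', x a * y a' * c = c := by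
    simp_rw [← Finset.sum_mul, ← Finset.mul_sum, hy.2, mul_one, hx.2, one_mul]
  rw [← h]
  unfold Er
  refine Finset.sum_le_sum fun a _ => Finset.sum_le_sum fun b _ => ?_
  exact mul_le_mul_of_nonneg_left (hr s a b) (mul_nonneg (hx.1 a) (hy.1 b))

lemma Er_neg {S A B : Type*} [Fintype A] [Fintype B]
    (r : S → A → B → ℝ) (x : A → ℝ) (y : B → ℝ) (s : S) :
    Er (fun s a b => - r s a b) x y s = - Er r x y s := by
  simp [Er]

lemma Ep_eq_Er {S A B : Type*} [Fintype S] [Fintype A] [Fintype B]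
    (p : S → A → B → S → ℝ) (x : A → ℝ) (y : B → ℝ) (V : S → ℝ) (s : S) :
    Ep p x y V s = Er (fun s a b => ∑ s', p s a b s' * V s') x y s := by
  simp only [Ep, Er, Finset.mul_sum, mul_assoc]

lemma Ep_le {S A B : Type*} [Fintype S] [Fintype A] [Fintype B]
    (p : S → A → B → S → ℝ) (hp0 : ∀ s a a' s', 0 ≤ p s a a' s')
    (hp1 : ∀ s a a', ∑ s', p s a a' s' = 1) (x : A → ℝ) (y : B → ℝ)
    (hx : IsProb x) (hy : IsProb y) (V : S → ℝ) (c : ℝ) (hV : ∀ s, V s ≤ c) (s : S) :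
    Ep p x y V s ≤ c := by
  rw [Ep_eq_Er]
  refine Er_le _ c (fun s a b => ?_) x y hx hy s
  calc ∑ s', p s a b s' * V s' ≤ ∑ s', p s a b s' * c :=
        Finset.sum_le_sum fun s' _ => mul_le_mul_of_nonneg_left (hV s') (hp0 s a b s')
    _ = c := by rw [← Finset.sum_mul, hp1, one_mul]

lemma Ep_sub {S A B : Type*} [Fintype S] [Fintype A] [Fintype B]
    (p : S → A → B → S → ℝ) (x : A → ℝ) (y : B → ℝ) (V W : S → ℝ) (s : S) :
    Ep p x y (fun s => V s - W s) s = Ep p x y V s - Ep p x y W s := by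
  simp only [Ep, mul_sub, Finset.sum_sub_distrib]

lemma Ep_neg {S A B : Type*} [Fintype S] [Fintype A] [Fintype B]
    (p : S → A → B → S → ℝ) (x : A → ℝ) (y : B → ℝ) (V : S → ℝ) (s : S) :
    Ep p x y (fun s => - V s) s = - Ep p x y V s := by
  simp [Ep]

lemma value_le {S A B : Type*} [Fintype S] [Fintype A] [Fintype B] [Nonempty S]
    (p : S → A → B → S → ℝ) (hp0 : ∀ s a a' s', 0 ≤ p s a a' s')
    (hp1 : ∀ s a a', ∑ s', p s a a' s' = 1)
    (π : S → A → ℝ) (σ : S → B → ℝ) (hπ : ∀ s, IsProb (π s)) (hσ : ∀ s, IsProb (σ s))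
    (γ : ℝ) (hγ0 : 0 ≤ γ) (hγ1 : γ < 1) (c : ℝ) (W : S → ℝ)
    (hW : ∀ s, W s ≤ c + γ * Ep p (π s) (σ s) W s) (s : S) : (1 - γ) * W s ≤ c := by
  obtain ⟨s0, h0⟩ := Finite.exists_max W
  have h1 := Ep_le p hp0 hp1 (π s0) (σ s0) (hπ s0) (hσ s0) W _ h0 s0
  have h2 := hW s0
  have h3 := mul_le_mul_of_nonneg_left h1 hγ0
  have h4 := mul_le_mul_of_nonneg_left (h0 s) (sub_nonneg.2 hγ1.le)
  linarith

lemma value_bounds {S A B : Type*} [Fintype S] [Fintype A] [Fintype B] [Nonempty S]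
    (p : S → A → B → S → ℝ) (hp0 : ∀ s a a' s', 0 ≤ p s a a' s')
    (hp1 : ∀ s a a', ∑ s', p s a a' s' = 1)
    (r : S → A → B → ℝ) (c : ℝ) (hr : ∀ s a a', |r s a a'| ≤ c)
    (π : S → A → ℝ) (σ : S → B → ℝ) (hπ : ∀ s, IsProb (π s)) (hσ : ∀ s, IsProb (σ s))
    (γ : ℝ) (hγ0 : 0 ≤ γ) (hγ1 : γ < 1) (W : S → ℝ)
    (hW : IsValue p r γ π σ W) (s : S) : (1 - γ) * W s ≤ c ∧ -c ≤ (1 - γ) * W s := by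
  constructor
  · refine value_le p hp0 hp1 π σ hπ hσ γ hγ0 hγ1 c W (fun s => ?_) s
    have := Er_le r c (fun s a b => (abs_le.1 (hr s a b)).2) _ _ (hπ s) (hσ s) s
    linarith [hW s]
  · have := value_le p hp0 hp1 π σ hπ hσ γ hγ0 hγ1 c (fun s => - W s) (fun s => ?_) s
    · linarith
    · have := Er_le (fun s a b => - r s a b) c
        (fun s a b => by linarith [(abs_le.1 (hr s a b)).1]) _ _ (hπ s) (hσ s) s
      rw [Er_neg] at this
      rw [Ep_neg]
      linarith [hW s]

lemma opt_value {S A B : Type*} [Fintype S] [Fintype A] [Fintype B] [Nonempty A]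
    (p : S → A → B → S → ℝ) (r : S → A → B → ℝ) (γ : ℝ)
    (σ : S → B → ℝ) (V : S → ℝ) (h : IsOptValue p r γ σ V) :
    ∃ π : S → A → ℝ, (∀ s, IsProb (π s)) ∧ IsValue p r γ π σ V := by
  classical
  have key : ∀ s, ∃ x : A → ℝ, IsProb x ∧ V s = Er r x (σ s) s + γ * Ep p x (σ s) V s := by
    intro s
    obtain ⟨a, -, ha⟩ := Finset.exists_mem_eq_sup' (Finset.univ_nonempty (α := A)) (fun a =>
      ∑ a', σ s a' * (r s a a' + γ * ∑ s', p s a a' s' * V s'))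
    refine ⟨fun b => if b = a then 1 else 0, ⟨fun i => by positivity, by simp⟩, ?_⟩
    rw [h s, ha, Ep_eq_Er]
    simp only [Er, ite_mul, one_mul, zero_mul, Finset.sum_ite_irrel, Finset.sum_const_zero,
      Finset.sum_ite_eq', Finset.mem_univ, if_true]
    rw [Finset.mul_sum, ← Finset.sum_add_distrib]
    exact Finset.sum_congr rfl fun b _ => by ring
  choose π h1 h2 using key
  exact ⟨π, h1, h2⟩

/-- **Theorem 3 (SBG Existence), risk bound:** with arbitrary (possibly wrong) beliefs `σ̃`, the
value-based strategy satisfies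
`max_s (V^{*,σ}(s) − V^{π,σ}(s)) ≤ (r_max/(1−λγ))·((4(1−γ²)+2)λ/(1−γ)² + (1−λ)(2−γ)/(1−γ))
  − γ(1−λ)ν/(1−λγ)`. -/
theorem sbg_risk_bound {S A B : Type*}
    [Fintype S] [Fintype A] [Fintype B] [Nonempty S] [Nonempty A] [Nonempty B]
    (p : S → A → B → S → ℝ) (hp0 : ∀ s a a' s', 0 ≤ p s a a' s')
    (hp1 : ∀ s a a', ∑ s', p s a a' s' = 1)
    (r : S → A → B → ℝ) (rmax : ℝ) (hr : ∀ s a a', |r s a a'| ≤ rmax)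
    (γ : ℝ) (hγ0 : 0 ≤ γ) (hγ1 : γ < 1)
    (lam : ℝ) (hlam0 : 0 ≤ lam) (hlam1 : lam ≤ 1)
    (σ σt σb : S → B → ℝ) (hσ : ∀ s, IsProb (σ s)) (hσt : ∀ s, IsProb (σt s))
    (hσb : ∀ s, IsProb (σb s))
    (Vstar Vt Vb : S → ℝ)
    (hVstar : IsOptValue p r γ σ Vstar) (hVt : IsOptValue p r γ σt Vt)
    (hVb : IsOptValue p r γ σb Vb)
    (ν : ℝ) (hν : ∀ s, ν ≤ Vb s)
    (π : S → A → ℝ) (hπ : ∀ s, IsProb (π s))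
    (hvalue_based : ∀ s, ∀ x : A → ℝ, IsProb x →
      lam * (Er r (π s) (σt s) s + γ * Ep p (π s) (σt s) Vt s) +
        (1 - lam) * (Er r (π s) (σb s) s + γ * Ep p (π s) (σb s) Vb s) ≥
      lam * (Er r x (σt s) s + γ * Ep p x (σt s) Vt s) +
        (1 - lam) * (Er r x (σb s) s + γ * Ep p x (σb s) Vb s))
    (Vπ Vπb : S → ℝ) (hVπ : IsValue p r γ π σ Vπ) (hVπb : IsValue p r γ π σb Vπb)
    (hdom : ∀ s, Vπb s ≤ Vπ s) :
    ∀ s, Vstar s - Vπ s ≤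
      rmax / (1 - lam * γ) *
        ((4 * (1 - γ ^ 2) + 2) * lam / (1 - γ) ^ 2 + (1 - lam) * (2 - γ) / (1 - γ)) -
      γ * (1 - lam) * ν / (1 - lam * γ) := by
  intro s
  have hg : 0 < 1 - γ := by linarith
  have hl : 0 < 1 - lam * γ := by nlinarith
  have hl' : 0 ≤ 1 - lam := by linarith
  have hR : 0 ≤ rmax := by
    obtain ⟨s⟩ := ‹Nonempty S›
    obtain ⟨a⟩ := ‹Nonempty A›
    obtain ⟨b⟩ := ‹Nonempty B›
    exact (abs_nonneg _).trans (hr s a b)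
  obtain ⟨πs, hs1, hs2⟩ := opt_value p r γ σ Vstar hVstar
  obtain ⟨πt, ht1, ht2⟩ := opt_value p r γ σt Vt hVt
  obtain ⟨πb, hb1, hb2⟩ := opt_value p r γ σb Vb hVb
  have bs := value_bounds p hp0 hp1 r rmax hr πs σ hs1 hσ γ hγ0 hγ1 Vstar hs2
  have bt := value_bounds p hp0 hp1 r rmax hr πt σt ht1 hσt γ hγ0 hγ1 Vt ht2
  have bb := value_bounds p hp0 hp1 r rmax hr πb σb hb1 hσb γ hγ0 hγ1 Vb hb2
  have bπ := value_bounds p hp0 hp1 r rmax hr π σ hπ hσ γ hγ0 hγ1 Vπ hVπ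
  set G := rmax / (1 - γ) with hG
  have hGR : (1 - γ) * G = rmax := by rw [hG]; field_simp
  have cancel : ∀ v w : ℝ, (1 - γ) * v ≤ (1 - γ) * w → v ≤ w :=
    fun v w h => le_of_mul_le_mul_left h hg
  -- bounds on the one-step lookahead against σt
  have lt : ∀ s, ∀ x : A → ℝ, IsProb x → Er r x (σt s) s + γ * Ep p x (σt s) Vt s ≤ G ∧
      -G ≤ Er r x (σt s) s + γ * Ep p x (σt s) Vt s := by
    intro s x hx
    have e1 := Er_le r rmax (fun s a b => (abs_le.1 (hr s a b)).2) _ _ hx (hσt s) s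
    have e2 := Er_le (fun s a b => - r s a b) rmax
        (fun s a b => by linarith [(abs_le.1 (hr s a b)).1]) _ _ hx (hσt s) s
    rw [Er_neg] at e2
    have e3 := Ep_le p hp0 hp1 x (σt s) hx (hσt s) Vt G
      (fun s => cancel _ _ (by rw [hGR]; exact (bt s).1)) s
    have e4 := Ep_le p hp0 hp1 x (σt s) hx (hσt s) (fun s => - Vt s) G
      (fun s => cancel _ _ (by rw [hGR]; linarith [(bt s).2])) s
    rw [Ep_neg] at e4
    have e5 := mul_le_mul_of_nonneg_left e3 hγ0
    have e6 := mul_le_mul_of_nonneg_left e4 hγ0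
    constructor <;> linarith
  have hdiff : ∀ s, (1 - γ) * ((1 - lam) * (Vb s - Vπb s)) ≤ 2 * lam * G := by
    refine value_le p hp0 hp1 π σb hπ hσb γ hγ0 hγ1 (2 * lam * G)
      (fun s => (1 - lam) * (Vb s - Vπb s)) (fun s => ?_)
    have h1 := hvalue_based s (πb s) (hb1 s)
    rw [← hb2 s] at h1
    have h2 := mul_le_mul_of_nonneg_left (lt s (π s) (hπ s)).1 hlam0
    have h3 := mul_le_mul_of_nonneg_left (lt s (πb s) (hb1 s)).2 hlam0
    have h4 := hVπb s
    have h5 : Ep p (π s) (σb s) (fun s => (1 - lam) * (Vb s - Vπb s)) s =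
        (1 - lam) * (Ep p (π s) (σb s) Vb s - Ep p (π s) (σb s) Vπb s) := by
      rw [← Ep_sub]
      simp only [Ep, Finset.mul_sum]
      refine Finset.sum_congr rfl fun a _ => Finset.sum_congr rfl fun b _ =>
        Finset.sum_congr rfl fun s' _ => by ring
    rw [h5]
    have h6 : (1 - lam) * Vπb s =
        (1 - lam) * (Er r (π s) (σb s) s + γ * Ep p (π s) (σb s) Vπb s) := by rw [← h4]
    linarith
  obtain ⟨s0, hs0⟩ := Finite.exists_min Vb
  have hν0 := hν s0
  have b0 := (bb s0).2
  have hd := hdiff s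
  have hdo := hdom s
  have hm := hs0 s
  have u1 : Vstar s ≤ G := cancel _ _ (by rw [hGR]; exact (bs s).1)
  have u2 : (1 - γ) * (Vstar s - Vπ s) ≤ 2 * rmax := by linarith [(bs s).1, (bπ s).2]
  set H := G / (1 - γ) with hH
  have hHG : (1 - γ) * H = G := by rw [hH]; field_simp
  have hd' : (1 - lam) * (Vb s - Vπb s) ≤ 2 * lam * H := cancel _ _ (by
    calc _ ≤ _ := hd
      _ = _ := by rw [← hHG]; ring)
  have hGR' : rmax ≤ G := by
    rw [hG, le_div_iff₀ hg]; nlinarith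
  have rhs : rmax / (1 - lam * γ) *
        ((4 * (1 - γ ^ 2) + 2) * lam / (1 - γ) ^ 2 + (1 - lam) * (2 - γ) / (1 - γ)) -
      γ * (1 - lam) * ν / (1 - lam * γ) =
      (lam * (4 * (1 + γ) * G + 2 * H) + (1 - lam) * (rmax + G - γ * ν)) / (1 - lam * γ) := by
    rw [hH, hG]
    field_simp
    ring
  rw [rhs, le_div_iff₀ hl]
  have k1 : (1 - lam) * (Vstar s - Vπ s) ≤ (1 - lam) * (G - Vb s0) + 2 * lam * H := by
    have : (1 - lam) * (Vstar s - Vπ s) ≤ (1 - lam) * ((G - Vb s0) + (Vb s - Vπb s)) :=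
      mul_le_mul_of_nonneg_left (by linarith) hl'
    linarith
  have k2 := mul_le_mul_of_nonneg_left u2 hlam0
  have k3 : (1 - lam) * (G - Vb s0) ≤ (1 - lam) * (rmax + G - γ * ν) := by
    refine mul_le_mul_of_nonneg_left ?_ hl'
    linarith [mul_le_mul_of_nonneg_left hν0 hγ0]
  have k4 : lam * (2 * rmax) ≤ lam * (4 * (1 + γ) * G) := by
    refine mul_le_mul_of_nonneg_left ?_ hlam0
    nlinarith [mul_nonneg hγ0 (hR.trans hGR')]
  linarith
end
end

section
/- (Theorem 4, stateless reduction.) Let a ≥ 2, b ≥ 2, γ ∈ (0,1), and let r_max, ν be reals with 0 ≤ ν ≤ r_max. There exist a nonempty compact set Θ ⊆ P_b and a matrix A ∈ ℝ^{a×b} (collecting total discounted payoffs of a stateless stochastic Bayesian game with per-step rewards bounded by r_max) with μ_Θ(A) ≤ r_max/(1−γ) and ν_Θ(A) ≥ ν such that for every λ ∈ [0,1] and every strategy π : conv(Θ) → P_a, if Δ(0;π) ≤ (1−λ)(r_max − ν)/(1−λγ) then the risk of π is at least (1+λ)(r_max − ν)/(1−λγ). -/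
open Finset

noncomputable section

lemma pay_e0 {a b : ℕ} (i0 : Fin a) (j0 : Fin b) (M c : ℝ) (x : Fin a → ℝ) (hx : x ∈ simplex a) (j : Fin b) :
    pay (fun i j => if j = j0 then (if i = i0 then M else c) else (if i = i0 then c else M)) x
      (Pi.single j 1) =
    if j = j0 then c + x i0 * (M - c) else M - x i0 * (M - c) := by
  have h1 : ∀ u v : ℝ, ∑ i, x i * (if i = i0 then u else v) = v + x i0 * (u - v) := by
    intro u v
    have : ∀ i, x i * (if i = i0 then u else v) = x i * v + (if i = i0 then x i * (u - v) else 0) := by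
      intro i; split_ifs <;> ring
    simp only [this, Finset.sum_add_distrib, ← Finset.sum_mul, hx.2]
    simp
  unfold pay
  simp only [Pi.single_apply, mul_ite, mul_one, mul_zero, Finset.sum_ite_eq', Finset.mem_univ,
    if_true]
  simp only [← mul_ite]
  split_ifs with h
  · rw [h1]
  · rw [h1]; ring

lemma simplex_le {a : ℕ} (x : Fin a → ℝ) (hx : x ∈ simplex a) (i : Fin a) : x i ≤ 1 := by
  rw [← hx.2]
  exact Finset.single_le_sum (fun i _ => hx.1 i) (Finset.mem_univ i)

lemma single_mem {a : ℕ} (i : Fin a) : (Pi.single i 1 : Fin a → ℝ) ∈ simplex a := by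
  refine ⟨fun k => ?_, by simp⟩
  rw [Pi.single_apply]; split_ifs <;> norm_num

/-- **Theorem 4 (SBG Impossibility), stateless reduction.** For `a ≥ 2`, `b ≥ 2`, `γ ∈ (0,1)` and
`0 ≤ ν ≤ r_max`, there are a nonempty compact `Θ ⊆ P_b` and a payoff matrix `A` with
`μ_Θ(A) ≤ r_max/(1−γ)` and `ν_Θ(A) ≥ ν` such that for every `λ ∈ [0,1]`, any strategy missing at
most `(1−λ)(r_max−ν)/(1−λγ)` opportunity incurs at least `(1+λ)(r_max−ν)/(1−λγ)` risk. -/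
theorem sbg_impossibility_stateless {a b : ℕ} (ha : 2 ≤ a) (hb : 2 ≤ b)
    (γ rmax ν : ℝ) (hγ0 : 0 < γ) (hγ1 : γ < 1) (hν0 : 0 ≤ ν) (hνr : ν ≤ rmax) :
    ∃ Θ : Set (Fin b → ℝ), Θ.Nonempty ∧ IsCompact Θ ∧ Θ ⊆ simplex b ∧
      ∃ A : Matrix (Fin a) (Fin b) ℝ,
        muTheta Θ A ≤ rmax / (1 - γ) ∧ ν ≤ nuTheta Θ A ∧
        ∀ lam : ℝ, 0 ≤ lam → lam ≤ 1 →
          ∀ π : (Fin b → ℝ) → (Fin a → ℝ),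
            (∀ yhat ∈ convexHull ℝ Θ, π yhat ∈ simplex a) →
            gap Θ A π 0 ≤ (1 - lam) * (rmax - ν) / (1 - lam * γ) →
            (1 + lam) * (rmax - ν) / (1 - lam * γ) ≤ risk Θ A π := by
  have hg : 0 < 1 - γ := by linarith
  obtain ⟨K, hK⟩ : ∃ K, K = (rmax - ν) / (1 - γ) := ⟨_, rfl⟩
  obtain ⟨M, hM⟩ : ∃ M, M = rmax / (1 - γ) := ⟨_, rfl⟩
  have hK0 : 0 ≤ K := hK ▸ div_nonneg (by linarith) hg.le
  have hKM : K ≤ M := by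
    rw [hK, hM]; gcongr; linarith
  have hνM : ν ≤ M := by
    rw [hM, le_div_iff₀ hg]; nlinarith
  let i0 : Fin a := ⟨0, by omega⟩
  let i1 : Fin a := ⟨1, by omega⟩
  let j0 : Fin b := ⟨0, by omega⟩
  let j1 : Fin b := ⟨1, by omega⟩
  have hi : i1 ≠ i0 := by simp [i0, i1]
  have hj : j1 ≠ j0 := by simp [j0, j1]
  let e0 : Fin b → ℝ := Pi.single j0 1
  let e1 : Fin b → ℝ := Pi.single j1 1
  obtain ⟨A, hA⟩ : ∃ A : Matrix (Fin a) (Fin b) ℝ, A = fun i j => if j = j0 then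
    (if i = i0 then M else M - 2 * K) else (if i = i0 then M - 2 * K else M) := ⟨_, rfl⟩
  have p0 : ∀ x ∈ simplex a, pay A x e0 = M - 2 * K + x i0 * (2 * K) := by
    intro x hx
    rw [hA, pay_e0 i0 j0 M (M - 2 * K) x hx j0, if_pos rfl]; ring
  have p1 : ∀ x ∈ simplex a, pay A x e1 = M - x i0 * (2 * K) := by
    intro x hx
    rw [hA, pay_e0 i0 j0 M (M - 2 * K) x hx j1, if_neg hj]; ring
  have bd : ∀ y ∈ ({e0, e1} : Set (Fin b → ℝ)), ∀ x ∈ simplex a, |pay A x y| ≤ M := by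
    intro y hy x hx
    have h0 := hx.1 i0
    have h1 := simplex_le x hx i0
    have h2 : 0 ≤ x i0 * K := mul_nonneg h0 hK0
    have h3 : x i0 * K ≤ K := mul_le_of_le_one_left hK0 h1
    rcases hy with rfl | rfl
    · rw [p0 x hx, abs_le]; constructor <;> linarith
    · rw [p1 x hx, abs_le]; constructor <;> linarith
  have hbr : ∀ y ∈ ({e0, e1} : Set (Fin b → ℝ)), br A y = M := by
    intro y hy
    apply IsGreatest.csSup_eq
    constructor
    · rcases hy with rfl | rfl
      · exact ⟨Pi.single i0 1, single_mem _, by rw [p0 _ (single_mem _)]; simp⟩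
      · exact ⟨Pi.single i1 1, single_mem _, by rw [p1 _ (single_mem _)]; simp [hi.symm]⟩
    · rintro v ⟨x, hx, rfl⟩
      exact (abs_le.1 (bd y hy x hx)).2
  have hM0 : 0 ≤ M := hν0.trans hνM
  have m0 : e0 ∈ ({e0, e1} : Set (Fin b → ℝ)) := by simp
  have m1 : e1 ∈ ({e0, e1} : Set (Fin b → ℝ)) := by simp
  refine ⟨{e0, e1}, ⟨e0, m0⟩, (Set.toFinite _).isCompact, ?_, A, ?_, ?_, ?_⟩
  · rintro y (rfl | rfl) <;> exact single_mem _
  · rw [← hM]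
    apply Real.sSup_le _ hM0
    rintro v ⟨y, hy, x, hx, rfl⟩
    exact bd y hy x hx
  · refine le_csInf ⟨br A e0, e0, m0, rfl⟩ ?_
    rintro v ⟨y, hy, rfl⟩
    rw [hbr y hy]; exact hνM
  · intro lam hl0 hl1 π hπ hgap
    have hub : ∀ ε : ℝ, ∀ v ∈ {v | ∃ ystar ∈ ({e0, e1} : Set (Fin b → ℝ)),
        ∃ yhat ∈ convexHull ℝ ({e0, e1} : Set (Fin b → ℝ)), l1 yhat ystar ≤ ε ∧
        v = br A ystar - pay A (π yhat) ystar}, v ≤ 2 * M := by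
      rintro ε v ⟨y, hy, z, hz, -, rfl⟩
      rw [hbr y hy]
      have := (abs_le.1 (bd y hy _ (hπ z hz))).1
      linarith
    have c0 := subset_convexHull ℝ _ m0
    have hp := hπ e0 c0
    have g0 : M - pay A (π e0) e0 ≤ gap {e0, e1} A π 0 := by
      apply le_csSup ⟨2 * M, hub 0⟩
      exact ⟨e0, m0, e0, c0, by simp [l1], by rw [hbr _ m0]⟩
    have hl1nn : 0 ≤ l1 e0 e1 := Finset.sum_nonneg fun _ _ => abs_nonneg _
    have g1 : M - pay A (π e0) e1 ≤ gap {e0, e1} A π (l1 e0 e1 + 1) := by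
      apply le_csSup ⟨2 * M, hub _⟩
      exact ⟨e1, m1, e0, c0, by linarith, by rw [hbr _ m1]⟩
    have g2 : gap {e0, e1} A π (l1 e0 e1 + 1) ≤ risk {e0, e1} A π := by
      apply le_csSup
      · refine ⟨2 * M, ?_⟩
        rintro v ⟨ε, -, rfl⟩
        exact Real.sSup_le (hub ε) (by linarith)
      · exact ⟨_, by linarith, rfl⟩
    rw [p0 _ hp] at g0
    rw [p1 _ hp] at g1
    have hlg : 1 - γ ≤ 1 - lam * γ := by nlinarith
    have hfin : (rmax - ν) / (1 - lam * γ) ≤ K := by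
      rw [hK]; exact div_le_div_of_nonneg_left (by linarith) hg hlg
    rw [mul_div_assoc] at hgap ⊢
    linarith
end
end
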